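/- arXiv:1912.07697 — 4 statements merged into one kernel-verified Lean document; each statement's English description precedes it below -/
import Mathlib

section
/- Let E be a real normed space, r a natural number, and C a set of twice continuously differentiable functions from E to (Fin r → ℝ). Suppose given an assignment X sending each α ∈ C to a continuously differentiable vector field X α : E → E, and define the bracket {α,β}(x) := (fderiv ℝ β x) (X α x). Assume that C is closed under the bracket, and that X intertwines the brackets with the Lie bracket of vector fields: for all α, β ∈ C and all x ∈ E, X {α,β} (x) = (fderiv ℝ (X β) x) (X α x) − (fderiv ℝ (X α) x) (X β x). Then for all α, β, γ ∈ C one has {{α,β},γ} = {α,{β,γ}} − {β,{α,γ}}. -/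
/-- Differentiating a `C²` map `f` along `V`, then along `W`, and antisymmetrizing, gives the
derivative of `f` along the Lie bracket of `V` and `W`. -/
theorem ContDiff.fderiv_apply_lieBracket_eq_sub
    {E F : Type*} [NormedAddCommGroup E] [NormedSpace ℝ E]
    [NormedAddCommGroup F] [NormedSpace ℝ F] {f : E → F} (hf : ContDiff ℝ 2 f)
    {V W : E → E} {x : E} (hV : DifferentiableAt ℝ V x) (hW : DifferentiableAt ℝ W x) :
    fderiv ℝ f x (fderiv ℝ W x (V x) - fderiv ℝ V x (W x))
      = fderiv ℝ (fun y => fderiv ℝ f y (W y)) x (V x)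
        - fderiv ℝ (fun y => fderiv ℝ f y (V y)) x (W x) := by
  have hdf : DifferentiableAt ℝ (fderiv ℝ f) x :=
    (hf.fderiv_right (m := 1) (by norm_num)).differentiable one_ne_zero x
  have hsymm : IsSymmSndFDerivAt ℝ f x := hf.contDiffAt.isSymmSndFDerivAt (by simp)
  rw [fderiv_clm_apply hdf hV, fderiv_clm_apply hdf hW]
  simp [hsymm.eq (V x) (W x)]

/-- For the bracket `{α,β}(x) = (dβ)_x (X_α x)` defined by an assignment of
Hamiltonian vector fields `X` compatible with the Lie bracket of vector fields,
one has `{{α,β},γ} = {α,{β,γ}} − {β,{α,γ}}`. -/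
theorem polyPoisson_bracket_leibniz_type
    {E : Type*} [NormedAddCommGroup E] [NormedSpace ℝ E] (r : ℕ)
    (C : Set (E → (Fin r → ℝ)))
    (hC : ∀ α ∈ C, ContDiff ℝ 2 α)
    (X : (E → (Fin r → ℝ)) → (E → E))
    (hX : ∀ α ∈ C, ContDiff ℝ 1 (X α))
    (hclosed : ∀ α ∈ C, ∀ β ∈ C,
      (fun x : E => (fderiv ℝ β x) (X α x)) ∈ C)
    (hLie : ∀ α ∈ C, ∀ β ∈ C, ∀ x : E,
      X (fun y : E => (fderiv ℝ β y) (X α y)) x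
        = (fderiv ℝ (X β) x) (X α x) - (fderiv ℝ (X α) x) (X β x)) :
    ∀ α ∈ C, ∀ β ∈ C, ∀ γ ∈ C,
      (fun x : E => (fderiv ℝ γ x) (X (fun y : E => (fderiv ℝ β y) (X α y)) x))
        = (fun x : E => (fderiv ℝ (fun y : E => (fderiv ℝ γ y) (X β y)) x) (X α x))
          - (fun x : E => (fderiv ℝ (fun y : E => (fderiv ℝ γ y) (X α y)) x) (X β x)) := by
  intro α hα β hβ γ hγ
  funext x
  simp only [Pi.sub_apply, hLie α hα β hβ x]
  exact (hC γ hγ).fderiv_apply_lieBracket_eq_sub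
    ((hX α hα).differentiable one_ne_zero x) ((hX β hβ).differentiable one_ne_zero x)
end

section
/- Let E be a real normed space, r a natural number, and C a set of twice continuously differentiable functions from E to (Fin r → ℝ). Suppose given an assignment X sending each α ∈ C to a continuously differentiable vector field X α : E → E, and define the bracket {α,β}(x) := (fderiv ℝ β x) (X α x). Assume: (a) C is closed under the bracket; (b) X intertwines the brackets with the Lie bracket of vector fields, i.e. for all α, β ∈ C and x ∈ E, X {α,β} (x) = (fderiv ℝ (X β) x) (X α x) − (fderiv ℝ (X α) x) (X β x); and (c) the bracket is skew-symmetric on C: {α,β} = −{β,α} for all α, β ∈ C. Then the bracket satisfies the Jacobi identity: for all α, β, γ ∈ C, {α,{β,γ}} + {β,{γ,α}} + {γ,{α,β}} = 0. -/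
/-- The commutator of the derivations along two differentiable vector fields is the derivation along
their Lie bracket. -/
theorem fderiv_fderiv_apply_sub_fderiv_fderiv_apply
    {E F : Type*} [NormedAddCommGroup E] [NormedSpace ℝ E] [NormedAddCommGroup F] [NormedSpace ℝ F]
    {f : E → F} {V W : E → E} {x : E} (hf : ContDiffAt ℝ 2 f x)
    (hV : DifferentiableAt ℝ V x) (hW : DifferentiableAt ℝ W x) :
    fderiv ℝ (fun y => fderiv ℝ f y (W y)) x (V x)
        - fderiv ℝ (fun y => fderiv ℝ f y (V y)) x (W x)
      = fderiv ℝ f x (fderiv ℝ W x (V x) - fderiv ℝ V x (W x)) := by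
  have hdf : DifferentiableAt ℝ (fderiv ℝ f) x :=
    (hf.fderiv_right (m := 1) (by norm_num)).differentiableAt (by norm_num)
  have hsymm : fderiv ℝ (fderiv ℝ f) x (V x) (W x) = fderiv ℝ (fderiv ℝ f) x (W x) (V x) :=
    hf.isSymmSndFDerivAt (by simp) (V x) (W x)
  rw [fderiv_clm_apply hdf hW, fderiv_clm_apply hdf hV]
  simp [hsymm]

/-- Jacobi identity for the bracket `{α,β}(x) = (dβ)_x (X_α x)` defined by an
assignment of Hamiltonian vector fields `X` compatible with the Lie bracket of
vector fields, assuming skew-symmetry of the bracket. -/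
theorem polyPoisson_bracket_jacobi
    {E : Type*} [NormedAddCommGroup E] [NormedSpace ℝ E] (r : ℕ)
    (C : Set (E → (Fin r → ℝ)))
    (hC : ∀ α ∈ C, ContDiff ℝ 2 α)
    (X : (E → (Fin r → ℝ)) → (E → E))
    (hX : ∀ α ∈ C, ContDiff ℝ 1 (X α))
    (hclosed : ∀ α ∈ C, ∀ β ∈ C,
      (fun x : E => (fderiv ℝ β x) (X α x)) ∈ C)
    (hLie : ∀ α ∈ C, ∀ β ∈ C, ∀ x : E,
      X (fun y : E => (fderiv ℝ β y) (X α y)) x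
        = (fderiv ℝ (X β) x) (X α x) - (fderiv ℝ (X α) x) (X β x))
    (hskew : ∀ α ∈ C, ∀ β ∈ C,
      (fun x : E => (fderiv ℝ β x) (X α x))
        = - (fun x : E => (fderiv ℝ α x) (X β x))) :
    ∀ α ∈ C, ∀ β ∈ C, ∀ γ ∈ C,
      (fun x : E => (fderiv ℝ (fun y : E => (fderiv ℝ γ y) (X β y)) x) (X α x))
        + (fun x : E => (fderiv ℝ (fun y : E => (fderiv ℝ α y) (X γ y)) x) (X β x))
        + (fun x : E => (fderiv ℝ (fun y : E => (fderiv ℝ β y) (X α y)) x) (X γ x))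
        = 0 := by
  intro α hα β hβ γ hγ
  funext x
  have hcomm := fderiv_fderiv_apply_sub_fderiv_fderiv_apply (hC γ hγ).contDiffAt
    ((hX α hα).differentiable (by norm_num) x) ((hX β hβ).differentiable (by norm_num) x)
  rw [← hLie α hα β hβ x] at hcomm
  have hγ_bracket := congrFun (hskew γ hγ _ (hclosed α hα β hβ)) x
  have hneg : fderiv ℝ (fun y => fderiv ℝ α y (X γ y)) x (X β x)
      = -fderiv ℝ (fun y => fderiv ℝ γ y (X α y)) x (X β x) := by
    rw [hskew γ hγ α hα, fderiv_neg, neg_apply]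
  simp only [Pi.add_apply, Pi.neg_apply, Pi.zero_apply] at hγ_bracket ⊢
  rw [hγ_bracket, hneg, ← hcomm]
  abel
end

section
/- Fix natural numbers n and r, and work in H := EuclideanSpace ℝ (Fin n), identifying covectors with vectors via the inner product. Let S be a submodule of (Fin r → H) whose annihilator is trivial: {X ∈ H | for all η ∈ S and all j, ⟪η j, X⟫ = 0} = {0}. Let a : [0,1] → H be continuous and u : [0,1] → (Fin r → H) be continuous with u t ∈ S for all t. Suppose that for every index j, every continuous b : [0,1] → H, and every continuous w : [0,1] → (Fin r → H) with w t ∈ S for all t, ∫ t in (0:ℝ)..1, (⟪w t j, a t⟫ − ⟪u t j, b t⟫) = 0. Then a = 0 and u = 0. -/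
open scoped RealInnerProductSpace

/-- A nonnegative function, continuous on `[a, b]` with `a < b` and of integral zero, vanishes on
`[a, b]`. -/
theorem ContinuousOn.eqOn_zero_of_intervalIntegral_eq_zero {f : ℝ → ℝ} {a b : ℝ} (hab : a < b)
    (hf : ContinuousOn f (Set.Icc a b)) (hnonneg : ∀ t, 0 ≤ f t) (hint : ∫ t in a..b, f t = 0) :
    Set.EqOn f 0 (Set.Icc a b) := by
  intro t ht
  by_contra hne
  exact (intervalIntegral.integral_pos hab hf (fun x _ ↦ hnonneg x)
    ⟨t, ht, lt_of_le_of_ne (hnonneg t) (Ne.symm hne)⟩).ne' hint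

/-- The restriction of the weak poly-symplectic forms of the boundary fields of
the poly-Poisson sigma model to paths in `S` still has trivial joint kernel,
using `S° = {0}`, in the local model `M = ℝⁿ` with `S` a constant subspace of
the `r`-fold sum of covectors (identified with vectors). -/
theorem polySigmaModel_paths_in_S_nondegenerate
    (n r : ℕ)
    (S : Submodule ℝ (Fin r → EuclideanSpace ℝ (Fin n)))
    (hS : {X : EuclideanSpace ℝ (Fin n) |
        ∀ η ∈ S, ∀ j : Fin r, ⟪η j, X⟫ = 0} = {0})
    (a : ℝ → EuclideanSpace ℝ (Fin n))
    (u : ℝ → (Fin r → EuclideanSpace ℝ (Fin n)))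
    (ha : ContinuousOn a (Set.Icc 0 1))
    (hu : ContinuousOn u (Set.Icc 0 1))
    (huS : ∀ t : ℝ, u t ∈ S)
    (h : ∀ (j : Fin r) (b : ℝ → EuclideanSpace ℝ (Fin n))
        (w : ℝ → (Fin r → EuclideanSpace ℝ (Fin n))),
      ContinuousOn b (Set.Icc 0 1) → ContinuousOn w (Set.Icc 0 1) →
      (∀ t : ℝ, w t ∈ S) →
      ∫ t in (0:ℝ)..1, (⟪w t j, a t⟫ - ⟪u t j, b t⟫) = 0) :
    Set.EqOn a 0 (Set.Icc 0 1) ∧ Set.EqOn u 0 (Set.Icc 0 1) := by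
  refine ⟨fun t ht ↦ ?_, fun t ht ↦ funext fun j ↦ ?_⟩
  · have hmem : a t ∈ {X : EuclideanSpace ℝ (Fin n) | ∀ η ∈ S, ∀ j : Fin r, ⟪η j, X⟫ = 0} := by
      intro η hη j
      have hg : ContinuousOn (fun s ↦ ⟪η j, a s⟫) (Set.Icc 0 1) :=
        continuousOn_const.inner (𝕜 := ℝ) ha
      have hint := h j 0 (fun s ↦ ⟪η j, a s⟫ • η) continuousOn_const
        (hg.smul continuousOn_const) (fun s ↦ S.smul_mem _ hη)
      simp only [Pi.smul_apply, Pi.zero_apply, real_inner_smul_left, inner_zero_right,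
        sub_zero] at hint
      exact mul_self_eq_zero.mp ((hg.mul hg).eqOn_zero_of_intervalIntegral_eq_zero zero_lt_one
        (fun s ↦ mul_self_nonneg _) hint ht)
    rwa [hS] at hmem
  · have hj : ContinuousOn (fun s ↦ u s j) (Set.Icc 0 1) := continuousOn_pi.mp hu j
    have hint := h j (fun s ↦ u s j) 0 hj continuousOn_const (fun _ ↦ S.zero_mem)
    simp only [Pi.zero_apply, inner_zero_left, zero_sub, intervalIntegral.integral_neg,
      neg_eq_zero] at hint
    exact inner_self_eq_zero.mp ((hj.inner (𝕜 := ℝ) hj).eqOn_zero_of_intervalIntegral_eq_zero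
      zero_lt_one (fun s ↦ real_inner_self_nonneg) hint ht)
end

section
/- Let T be a compact metric space and μ a finite Borel measure on T with full support (μ(U) > 0 for every nonempty open U ⊆ T). Let V be a finite-dimensional real normed space, r a natural number, and for each index j let ω_j : V →ₗ[ℝ] V →ₗ[ℝ] ℝ be a bilinear form; assume the forms have trivial joint kernel: if v ∈ V satisfies ω_j v w = 0 for all w ∈ V and all j, then v = 0. For continuous f, g : T → V and each j define the transgressed pairing Ω_j(f,g) := ∫ t, ω_j (f t) (g t) ∂μ. Then the transgressed pairings have trivial joint kernel: if f : T → V is continuous and Ω_j(f,g) = 0 for every continuous g : T → V and every j, then f = 0. -/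
open MeasureTheory

/-- AKSZ-type transgression preserves joint nondegeneracy: if the bilinear
forms `ω_j` on a finite-dimensional space `V` have trivial joint kernel and `μ`
is a finite Borel measure of full support on a compact metric space `T`, then
the transgressed pairings `Ω_j(f,g) = ∫ ω_j (f t) (g t) dμ` on `C(T, V)` have
trivial joint kernel. -/
theorem transgression_nondegenerate
    {T : Type*} [MetricSpace T] [CompactSpace T]
    [MeasurableSpace T] [BorelSpace T]
    (μ : Measure T) [IsFiniteMeasure μ]
    (hμ : ∀ U : Set T, IsOpen U → U.Nonempty → 0 < μ U)
    {V : Type*} [NormedAddCommGroup V] [NormedSpace ℝ V]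
    [FiniteDimensional ℝ V]
    (r : ℕ) (ω : Fin r → (V →ₗ[ℝ] V →ₗ[ℝ] ℝ))
    (hω : ∀ v : V, (∀ (j : Fin r) (w : V), ω j v w = 0) → v = 0)
    (f : T → V) (hf : Continuous f)
    (h : ∀ (g : T → V), Continuous g → ∀ j : Fin r,
      ∫ t, ω j (f t) (g t) ∂μ = 0) :
    f = 0 := by
  have : μ.IsOpenPosMeasure := ⟨fun U hU hne => (hμ U hU hne).ne'⟩
  funext t₀
  refine hω _ fun j w => ?_
  have hφ : Continuous fun t => ω j (f t) w :=
    ((ω j).flip w).continuous_of_finiteDimensional.comp hf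
  have hint := h (fun t => ω j (f t) w • w) (hφ.smul continuous_const) j
  simp only [map_smul, smul_eq_mul] at hint
  by_contra hne
  exact ((hφ.mul hφ).integral_pos_of_hasCompactSupport_nonneg_nonzero
    (.of_compactSpace _) (fun t => mul_self_nonneg _)
    (mul_self_ne_zero.mpr hne : ω j (f t₀) w * ω j (f t₀) w ≠ 0)).ne' hint
end
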